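/- arXiv:2206.09402 — 2 statements merged into one kernel-verified Lean document; each statement's English description precedes it below -/
import Mathlib

section
/- Suppose Condition (C) holds. Then Q_{k+1}^{k+n}(k, k+n) / Q_{k+1}^{k+n+1}(k, k+n) → −σ^{−1} uniformly in k ≥ 1 as n → ∞; that is, sup_{k≥1} |Q_{k+1}^{k+n}(k,k+n)/Q_{k+1}^{k+n+1}(k,k+n) + σ^{−1}| → 0 as n → ∞. -/
open Filter MeasureTheory ENNReal Topology

noncomputable section

/-- Transition function of the (1,2) random walk `Y`. -/
def transY (q p1 p2 : ℕ → ℝ) (n j : ℕ) : ℝ :=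
  if n = 0 then (if j = 2 then 1 else 0)
  else if n = 1 then (if j = 0 then 1 else 0)
  else if j = n - 1 then q n
  else if j = n + 1 then p1 n
  else if j = n + 2 then p2 n
  else 0

/-- `μ` is the law (on path space) of the time-homogeneous Markov chain on `ℕ`
with one-step transition probabilities `p` and initial state `init`. -/
def IsMarkovChain (μ : Measure (ℕ → ℕ)) (p : ℕ → ℕ → ℝ) (init : ℕ) : Prop :=
  μ {ω | ω 0 = init} = 1 ∧
  ∀ (k : ℕ) (x : ℕ → ℕ) (j : ℕ),
    μ {ω | (∀ i ≤ k, ω i = x i) ∧ ω (k + 1) = j}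
      = ENNReal.ofReal (p (x k) j) * μ {ω | ∀ i ≤ k, ω i = x i}

/-- `Q_k^j(m,n)`: the probability that the walk started at `k` hits `[n,∞)` before
`[0,m]`, entering `[n,∞)` at the site `j`. Here `μ x` is the law of the walk started
at `x`. -/
def QY (μ : ℕ → Measure (ℕ → ℕ)) (k j m n : ℕ) : ℝ≥0∞ :=
  (μ k) {ω | ∃ t, ω t = j ∧ ∀ i < t, m < ω i ∧ ω i < n}

/-- the uniform filter -/
abbrev UF : Filter (ℕ × ℕ) := (⊤ : Filter ℕ) ×ˢ atTop

lemma uf_ev {P : ℕ × ℕ → Prop} : (∀ᶠ x in UF, P x) ↔ ∃ N, ∀ n, N ≤ n → ∀ m, P (m, n) := by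
  unfold UF
  rw [← Filter.principal_univ, Filter.prod_comm, Filter.eventually_map,
    Filter.eventually_prod_principal_iff, Filter.eventually_atTop]
  simp

lemma uf_shift (p : ℕ) : Tendsto (fun x : ℕ × ℕ => (x.1, x.2 + p)) UF UF := by
  rw [tendsto_iff_forall_eventually_mem]
  intro s hs
  obtain ⟨N, hN⟩ := uf_ev.1 (show ∀ᶠ x in UF, x ∈ s from hs)
  exact uf_ev.2 ⟨N, fun n hn m => hN _ (by omega) _⟩

lemma uf_idx (c : ℕ) (u : ℕ → ℝ) (l : ℝ) (hu : Tendsto u atTop (𝓝 l)) :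
    Tendsto (fun x : ℕ × ℕ => u (x.1 + x.2 + c)) UF (𝓝 l) := by
  refine hu.comp ?_
  rw [tendsto_atTop]
  intro b
  exact uf_ev.2 ⟨b, fun n hn m => by simp only; omega⟩

lemma uf_contract (p : ℕ) (e δ : ℕ × ℕ → ℝ) (c B : ℝ) (hc0 : 0 ≤ c) (hc1 : c < 1)
    (he : ∀ x, 0 ≤ e x) (hB : ∀ x, e x ≤ B) (hδ : Tendsto δ UF (𝓝 0))
    (h : ∀ᶠ x in UF, e (x.1, x.2 + p) ≤ c * e x + δ x) : Tendsto e UF (𝓝 0) := by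
  have key : ∀ η : ℝ, 0 < η → ∀ j : ℕ, ∀ᶠ x in UF, e x ≤ c ^ j * B + η / (1 - c) := by
    intro η hη j
    have h1c : 0 < 1 - c := by linarith
    induction j with
    | zero =>
      refine Eventually.of_forall fun x => ?_
      have := hB x
      have := div_pos hη h1c
      simp only [pow_zero, one_mul]; linarith
    | succ j ih =>
      have hd : ∀ᶠ x in UF, δ x < η := hδ.eventually_lt_const hη
      obtain ⟨N, hN⟩ := uf_ev.1 ((ih.and h).and hd)
      refine uf_ev.2 ⟨N + p, fun n hn m => ?_⟩
      obtain ⟨⟨h1, h2⟩, h3⟩ := hN (n - p) (by omega) m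
      simp only at h2
      rw [Nat.sub_add_cancel (by omega)] at h2
      have h4 := mul_le_mul_of_nonneg_left h1 hc0
      have h5 : c * (c ^ j * B + η / (1 - c)) + η = c ^ (j + 1) * B + η / (1 - c) := by
        field_simp; ring
      linarith
  rw [Metric.tendsto_nhds]
  intro ε hε
  have h1c : 0 < 1 - c := by linarith
  have hj : Tendsto (fun j : ℕ => c ^ j * B) atTop (𝓝 0) := by
    simpa using (tendsto_pow_atTop_nhds_zero_of_lt_one hc0 hc1).mul_const B
  obtain ⟨j, hj⟩ := (hj.eventually_lt_const (half_pos hε)).exists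
  filter_upwards [key (ε / 4 * (1 - c)) (by positivity) j] with x hx
  rw [Real.dist_eq, sub_zero, abs_of_nonneg (he x)]
  rw [mul_div_assoc, div_self h1c.ne'] at hx
  linarith

/-- continued-fraction sequence -/
def ys (A B : ℕ → ℝ) (m : ℕ) : ℕ → ℝ
  | 0 => 0
  | j + 1 => B (m + j + 1) / (A (m + j + 1) + ys A B m j)

def ws (A B : ℕ → ℝ) (m : ℕ) : ℕ → ℝ
  | 0 => 1
  | j + 1 => 1 - ws A B m j * ys A B m j

lemma ys_mem (A B : ℕ → ℝ) (m : ℕ) (hm : 1 ≤ m) (hB : ∀ k, 2 ≤ k → 0 < B k)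
    (hAB : ∀ k, 2 ≤ k → B k ≤ A k) (j : ℕ) : 0 ≤ ys A B m j ∧ ys A B m j ≤ 1 := by
  induction j with
  | zero => simp [ys]
  | succ j ih =>
    have h1 := hB (m + j + 1) (by omega)
    have h2 := hAB (m + j + 1) (by omega)
    rw [ys]
    constructor
    · apply div_nonneg <;> linarith
    · rw [div_le_one] <;> linarith

lemma ws_mem (A B : ℕ → ℝ) (m : ℕ) (hm : 1 ≤ m) (hB : ∀ k, 2 ≤ k → 0 < B k)
    (hAB : ∀ k, 2 ≤ k → B k ≤ A k) (j : ℕ) : 0 ≤ ws A B m j ∧ ws A B m j ≤ 1 := by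
  induction j with
  | zero => simp [ws]
  | succ j ih =>
    obtain ⟨h1, h2⟩ := ys_mem A B m hm hB hAB j
    rw [ws]
    constructor
    · nlinarith
    · nlinarith

lemma ys_lim (A B : ℕ → ℝ) (a b y : ℝ) (ha : 0 < a) (hb : 0 < b) (hy : 0 < y)
    (hB : ∀ k, 2 ≤ k → 0 < B k)
    (hAB : ∀ k, 2 ≤ k → B k ≤ A k) (hyb : y * (a + y) = b)
    (hA : Tendsto A atTop (𝓝 a)) (hBt : Tendsto B atTop (𝓝 b)) :
    Tendsto (fun x : ℕ × ℕ => ys A B (x.1 + 1) x.2) UF (𝓝 y) := by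
  set Y : ℕ × ℕ → ℝ := fun x => ys A B (x.1 + 1) x.2 with hY
  have hY0 : ∀ x, 0 ≤ Y x := fun x => (ys_mem A B _ (by omega) hB hAB _).1
  have hY1 : ∀ x, Y x ≤ 1 := fun x => (ys_mem A B _ (by omega) hB hAB _).2
  set T : ℝ → ℝ := fun z => b / (a + z) with hT
  set δ : ℕ × ℕ → ℝ := fun x => |Y (x.1, x.2 + 1) - T (Y x)| with hδ
  have hA' := uf_idx 2 A a hA
  have hB' := uf_idx 2 B b hBt
  have hδ0 : Tendsto δ UF (𝓝 0) := by
    have hlim : Tendsto (fun x : ℕ × ℕ => |B (x.1 + x.2 + 2) - b| / A (x.1 + x.2 + 2)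
        + b * |a - A (x.1 + x.2 + 2)| / (a * A (x.1 + x.2 + 2))) UF (𝓝 0) := by
      have h1 := ((hB'.sub_const b).abs.div hA' ha.ne').add
        (((hA'.const_sub a).abs.const_mul b).div (hA'.const_mul a) (by positivity))
      simpa using h1
    refine squeeze_zero (fun x => abs_nonneg _) (fun x => ?_) hlim
    have e : Y (x.1, x.2 + 1) = B (x.1 + x.2 + 2) / (A (x.1 + x.2 + 2) + Y x) := by
      simp only [hY, ys]
      rw [show x.1 + 1 + x.2 + 1 = x.1 + x.2 + 2 by ring]
    have hb2 := hB (x.1 + x.2 + 2) (by omega)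
    have ha2 := hAB (x.1 + x.2 + 2) (by omega)
    have h0 := hY0 x
    simp only [hδ, hT, e]
    generalize Y x = z at *
    generalize B (x.1 + x.2 + 2) = β at *
    generalize A (x.1 + x.2 + 2) = α at *
    have hα : 0 < α := by linarith
    have e2 : β / (α + z) - b / (a + z) = (β - b) / (α + z) + b * (a - α) / ((a + z) * (α + z)) := by
      field_simp; ring
    rw [e2]
    refine (abs_add_le _ _).trans (add_le_add ?_ ?_)
    · rw [abs_div, abs_of_pos (show 0 < α + z by linarith)]
      gcongr; linarith
    · rw [abs_div, abs_mul, abs_of_pos hb, abs_of_pos (show 0 < (a + z) * (α + z) by positivity)]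
      gcongr <;> linarith
  have hTL : ∀ u v, 0 ≤ u → 0 ≤ v → |T u - T v| ≤ b / a ^ 2 * |u - v| := by
    intro u v hu hv
    have : T u - T v = b / ((a + u) * (a + v)) * (v - u) := by
      simp only [hT]; field_simp; ring
    rw [this, abs_mul, abs_sub_comm v u, abs_of_pos (by positivity)]
    gcongr
    nlinarith [mul_nonneg hu hv]
  have hTT : ∀ u, 0 ≤ u → |T (T u) - y| ≤ (b / (a ^ 2 + b)) ^ 2 * |u - y| := by
    intro u hu
    have hyT : y = b * (a + y) / (a ^ 2 + a * y + b) := by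
      rw [_root_.eq_div_iff (by positivity)]; linear_combination a * hyb
    have : T (T u) - y = b ^ 2 / ((a ^ 2 + a * u + b) * (a ^ 2 + a * y + b)) * (u - y) := by
      have e1 : T (T u) = b * (a + u) / (a ^ 2 + a * u + b) := by
        simp only [hT]; field_simp
      rw [e1]; nth_rewrite 1 [hyT]
      field_simp; ring
    rw [this, abs_mul, abs_of_pos (by positivity), div_pow]
    gcongr
    have := mul_nonneg ha.le hu
    have := mul_nonneg ha.le hy.le
    nlinarith [sq_nonneg a]
  have hδ1 : Tendsto (fun x : ℕ × ℕ => δ (x.1, x.2 + 1)) UF (𝓝 0) := hδ0.comp (uf_shift 1)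
  have hc : b / (a ^ 2 + b) < 1 := by rw [div_lt_one (by positivity)]; nlinarith
  have hc0 : 0 ≤ b / (a ^ 2 + b) := by positivity
  have hfin := uf_contract 2 (fun x => |Y x - y|) (fun x => δ (x.1, x.2 + 1) + b / a ^ 2 * δ x)
    ((b / (a ^ 2 + b)) ^ 2) (1 + y) (by positivity) (by nlinarith) (fun x => abs_nonneg _)
    (fun x => by rw [abs_le]; constructor <;> linarith [hY0 x, hY1 x])
    (by simpa using hδ1.add (hδ0.const_mul (b / a ^ 2)))
    (Eventually.of_forall fun x => by
      have h1 := hTL (Y (x.1, x.2 + 1)) (T (Y x)) (hY0 _) (by have := hY0 x; simp only [hT]; positivity)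
      have h2 := hTT (Y x) (hY0 x)
      have e : Y (x.1, x.2 + 2) - y = (Y (x.1, x.2 + 2) - T (Y (x.1, x.2 + 1)))
        + (T (Y (x.1, x.2 + 1)) - T (T (Y x))) + (T (T (Y x)) - y) := by ring
      rw [e]
      refine (abs_add_three _ _ _).trans ?_
      have h3 : |Y (x.1, x.2 + 2) - T (Y (x.1, x.2 + 1))| = δ (x.1, x.2 + 1) := rfl
      have h4 : |Y (x.1, x.2 + 1) - T (Y x)| = δ x := rfl
      rw [h4] at h1
      linarith)
  rw [tendsto_iff_dist_tendsto_zero]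
  simpa [Real.dist_eq] using hfin

lemma ws_lim (A B : ℕ → ℝ) (y : ℝ) (hy : 0 < y) (hy1 : y < 1)
    (hB : ∀ k, 2 ≤ k → 0 < B k)
    (hAB : ∀ k, 2 ≤ k → B k ≤ A k)
    (hY : Tendsto (fun x : ℕ × ℕ => ys A B (x.1 + 1) x.2) UF (𝓝 y)) :
    Tendsto (fun x : ℕ × ℕ => ws A B (x.1 + 1) x.2) UF (𝓝 (1 / (1 + y))) := by
  have hW := fun x : ℕ × ℕ => ws_mem A B (x.1 + 1) (by omega) hB hAB x.2
  have hw1 : 1 / (1 + y) ≤ 1 := by rw [div_le_one] <;> linarith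
  have hw0 : 0 < 1 / (1 + y) := by positivity
  have hfin := uf_contract 1 (fun x => |ws A B (x.1 + 1) x.2 - 1 / (1 + y)|)
    (fun x => |ys A B (x.1 + 1) x.2 - y|) y 1 hy.le hy1 (fun x => abs_nonneg _)
    (fun x => by rw [abs_le]; constructor <;> linarith [(hW x).1, (hW x).2])
    (by simpa using (hY.sub_const y).abs)
    (Eventually.of_forall fun x => by
      simp only [ws]
      have e : 1 - ws A B (x.1 + 1) x.2 * ys A B (x.1 + 1) x.2 - 1 / (1 + y)
        = - (y * (ws A B (x.1 + 1) x.2 - 1 / (1 + y)))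
          - ws A B (x.1 + 1) x.2 * (ys A B (x.1 + 1) x.2 - y) := by
        field_simp; ring
      rw [e]
      refine (abs_sub _ _).trans ?_
      rw [abs_neg, abs_mul, abs_mul, abs_of_pos hy, abs_of_nonneg (hW x).1]
      nlinarith [(hW x).2, abs_nonneg (ys A B (x.1 + 1) x.2 - y)])
  rw [tendsto_iff_dist_tendsto_zero]
  simpa [Real.dist_eq] using hfin

lemma markov_step (μ : Measure (ℕ → ℕ)) [IsProbabilityMeasure μ] (p : ℕ → ℕ → ℝ) (init : ℕ)
    (h : IsMarkovChain μ p init) (m n t y x : ℕ) :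
    μ {ω | ((∀ i < t, m < ω i ∧ ω i < n) ∧ ω t = y) ∧ ω (t + 1) = x}
      = ENNReal.ofReal (p y x) * μ {ω | (∀ i < t, m < ω i ∧ ω i < n) ∧ ω t = y} := by
  set f : (ℕ → ℕ) → (Fin (t + 1) → ℕ) := fun ω i => ω i with hf
  have hfm : Measurable f := by
    rw [measurable_pi_iff]; intro i; exact measurable_pi_apply _
  set s : Set (Fin (t + 1) → ℕ) :=
    {v | (∀ i : Fin (t + 1), i.1 < t → m < v i ∧ v i < n) ∧ v (Fin.last t) = y} with hs
  have hpre : f ⁻¹' s = {ω | (∀ i < t, m < ω i ∧ ω i < n) ∧ ω t = y} := by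
    ext ω
    simp only [hs, hf, Set.mem_preimage, Set.mem_ofPred_eq, Fin.val_last]
    constructor
    · rintro ⟨h1, h2⟩
      exact ⟨fun i hi => h1 ⟨i, by omega⟩ hi, h2⟩
    · rintro ⟨h1, h2⟩
      exact ⟨fun i hi => h1 i hi, h2⟩
  have hE : MeasurableSet {ω : ℕ → ℕ | ω (t + 1) = x} :=
    measurableSet_eq_fun (measurable_pi_apply (t + 1)) measurable_const
  have hsing : ∀ v : Fin (t + 1) → ℕ, MeasurableSet (f ⁻¹' {v}) := fun v =>
    hfm (MeasurableSet.singleton v)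
  have h1 := tsum_measure_preimage_singleton (μ := μ.restrict {ω : ℕ → ℕ | ω (t + 1) = x})
    (Set.to_countable s) (f := f) (fun v _ => hsing v)
  have h2 := tsum_measure_preimage_singleton (μ := μ)
    (Set.to_countable s) (f := f) (fun v _ => hsing v)
  rw [Measure.restrict_apply' hE, hpre] at h1
  rw [hpre] at h2
  have : {ω : ℕ → ℕ | ((∀ i < t, m < ω i ∧ ω i < n) ∧ ω t = y) ∧ ω (t + 1) = x}
    = {ω | (∀ i < t, m < ω i ∧ ω i < n) ∧ ω t = y} ∩ {ω | ω (t + 1) = x} := rfl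
  rw [this, ← h1, ← h2, ← ENNReal.tsum_mul_left]
  refine tsum_congr fun v => ?_
  rw [Measure.restrict_apply' hE]
  set xx : ℕ → ℕ := fun i => if hi : i < t + 1 then v.1 ⟨i, hi⟩ else 0 with hxx
  have e : f ⁻¹' {v.1} = {ω | ∀ i ≤ t, ω i = xx i} := by
    ext ω
    simp only [hf, Set.mem_preimage, Set.mem_singleton_iff, Set.mem_ofPred_eq, hxx]
    constructor
    · intro hh i hi
      rw [dif_pos (by omega), ← hh]
    · intro hh
      funext i
      rw [hh i (by omega), dif_pos (by omega)]
  have hm := h.2 t xx x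
  have hxt : xx t = y := by
    simp only [hxx]; rw [dif_pos (by omega)]; exact v.2.2
  rw [hxt] at hm
  rw [e]
  exact hm

/-- mass surviving up to time `t`, located at `x` -/
def Smass (μ : Measure (ℕ → ℕ)) (m n t x : ℕ) : ℝ :=
  (μ {ω | (∀ i < t, m < ω i ∧ ω i < n) ∧ ω t = x}).toReal

lemma Smass_nonneg (μ : Measure (ℕ → ℕ)) (m n t x : ℕ) : 0 ≤ Smass μ m n t x :=
  ENNReal.toReal_nonneg

lemma meas_S (m n t x : ℕ) :
    MeasurableSet {ω : ℕ → ℕ | (∀ i < t, m < ω i ∧ ω i < n) ∧ ω t = x} := by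
  have : {ω : ℕ → ℕ | (∀ i < t, m < ω i ∧ ω i < n) ∧ ω t = x}
    = (⋂ i ∈ Finset.range t, (fun ω : ℕ → ℕ => ω i) ⁻¹' (Set.Ioo m n))
      ∩ (fun ω : ℕ → ℕ => ω t) ⁻¹' {x} := by
    ext ω; simp
  rw [this]
  refine MeasurableSet.inter (Finset.measurableSet_biInter _ fun i _ => ?_) ?_
  · exact measurable_pi_apply i (MeasurableSet.of_discrete)
  · exact measurable_pi_apply t (MeasurableSet.of_discrete)

lemma Smass_succ (μ : Measure (ℕ → ℕ)) [IsProbabilityMeasure μ] (p : ℕ → ℕ → ℝ) (init : ℕ)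
    (h : IsMarkovChain μ p init) (m n t x : ℕ)
    (hp : ∀ y ∈ Finset.Ioo m n, 0 ≤ p y x) :
    Smass μ m n (t + 1) x = ∑ y ∈ Finset.Ioo m n, Smass μ m n t y * p y x := by
  have hun : {ω : ℕ → ℕ | (∀ i < t + 1, m < ω i ∧ ω i < n) ∧ ω (t + 1) = x}
    = ⋃ y ∈ Finset.Ioo m n,
      {ω | ((∀ i < t, m < ω i ∧ ω i < n) ∧ ω t = y) ∧ ω (t + 1) = x} := by
    ext ω
    simp only [Set.mem_ofPred_eq, Set.mem_iUnion, Finset.mem_Ioo, exists_prop]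
    constructor
    · rintro ⟨h1, h2⟩
      exact ⟨ω t, h1 t (by omega), ⟨fun i hi => h1 i (by omega), rfl⟩, h2⟩
    · rintro ⟨y, hy, ⟨h1, h3⟩, h2⟩
      refine ⟨fun i hi => ?_, h2⟩
      rcases Nat.lt_succ_iff_lt_or_eq.1 hi with hi | hi
      · exact h1 i hi
      · rw [hi, h3]; exact hy
  have hE : MeasurableSet {ω : ℕ → ℕ | ω (t + 1) = x} :=
    measurableSet_eq_fun (measurable_pi_apply (t + 1)) measurable_const
  rw [Smass, hun, measure_biUnion_finset]
  · rw [ENNReal.toReal_sum (fun y _ => measure_ne_top _ _)]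
    refine Finset.sum_congr rfl fun y hy => ?_
    rw [markov_step μ p init h, ENNReal.toReal_mul, ENNReal.toReal_ofReal (hp y hy), mul_comm]
    rfl
  · intro y _ z _ hyz
    rw [Function.onFun, Set.disjoint_left]
    rintro ω ⟨⟨_, h1⟩, _⟩ ⟨⟨_, h2⟩, _⟩
    exact hyz (h1.symm.trans h2)
  · intro y _
    exact (meas_S m n t y).inter hE

lemma Q_hasSum (μ : Measure (ℕ → ℕ)) [IsProbabilityMeasure μ] (m n j : ℕ) (hj : n ≤ j) :
    HasSum (fun t => Smass μ m n t j)
      (μ {ω | ∃ t, ω t = j ∧ ∀ i < t, m < ω i ∧ ω i < n}).toReal := by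
  have e : {ω : ℕ → ℕ | ∃ t, ω t = j ∧ ∀ i < t, m < ω i ∧ ω i < n}
    = ⋃ t, {ω | (∀ i < t, m < ω i ∧ ω i < n) ∧ ω t = j} := by
    ext ω; simp [and_comm]
  have hd : μ (⋃ t, {ω | (∀ i < t, m < ω i ∧ ω i < n) ∧ ω t = j})
      = ∑' t, μ {ω | (∀ i < t, m < ω i ∧ ω i < n) ∧ ω t = j} := by
    refine measure_iUnion ?_ (fun t => meas_S m n t j)
    intro s t hst
    rw [Function.onFun, Set.disjoint_left]
    rintro ω ⟨h1, h2⟩ ⟨h3, h4⟩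
    rcases lt_or_gt_of_ne hst with h | h
    · have := h3 s h; omega
    · have := h1 t h; omega
  have hne : ∑' t, μ {ω | (∀ i < t, m < ω i ∧ ω i < n) ∧ ω t = j} ≠ ∞ := by
    rw [← hd]; exact measure_ne_top _ _
  rw [e, hd, ENNReal.tsum_toReal_eq (fun t => measure_ne_top _ _)]
  exact (ENNReal.summable_toReal hne).hasSum

lemma transY_nonneg (q p1 p2 : ℕ → ℝ)
    (hq : ∀ k, 2 ≤ k → 0 < q k) (hp1 : ∀ k, 2 ≤ k → 0 ≤ p1 k)
    (hp2 : ∀ k, 2 ≤ k → 0 < p2 k) (y x : ℕ) (hy : 2 ≤ y) : 0 ≤ transY q p1 p2 y x := by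
  have := hq y hy
  have := hp1 y hy
  have := hp2 y hy
  unfold transY
  rw [if_neg (by omega), if_neg (by omega)]
  split_ifs <;> linarith

lemma transY_sum (q p1 p2 : ℕ → ℝ) (m n y : ℕ) (hy : 2 ≤ y) (hmy : m < y) (hyn : y < n)
    (f : ℕ → ℝ) : ∑ x ∈ Finset.Icc m (n + 1), transY q p1 p2 y x * f x
      = q y * f (y - 1) + p1 y * f (y + 1) + p2 y * f (y + 2) := by
  have e : ∀ x, transY q p1 p2 y x * f x = (if x = y - 1 then q y * f x else 0)
      + (if x = y + 1 then p1 y * f x else 0) + (if x = y + 2 then p2 y * f x else 0) := by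
    intro x
    unfold transY
    rw [if_neg (by omega), if_neg (by omega)]
    split_ifs <;> first | omega | simp
  simp_rw [e, Finset.sum_add_distrib, Finset.sum_ite_eq']
  rw [if_pos (by simp; omega), if_pos (by simp; omega), if_pos (by simp; omega)]

/-- one-step identity -/
lemma step_id (q p1 p2 : ℕ → ℝ)
    (hq : ∀ k, 2 ≤ k → 0 < q k) (hp1 : ∀ k, 2 ≤ k → 0 ≤ p1 k)
    (hp2 : ∀ k, 2 ≤ k → 0 < p2 k)
    (μ : Measure (ℕ → ℕ)) [IsProbabilityMeasure μ] (init : ℕ)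
    (hμ : IsMarkovChain μ (transY q p1 p2) init) (m n : ℕ) (hm : 1 ≤ m) (hmn : m < n)
    (f : ℕ → ℝ) (t : ℕ) :
    ∑ y ∈ Finset.Ioo m n, Smass μ m n t y * (q y * f (y - 1) + p1 y * f (y + 1) + p2 y * f (y + 2))
      = Smass μ m n (t + 1) m * f m + ∑ y ∈ Finset.Ioo m n, Smass μ m n (t + 1) y * f y
        + Smass μ m n (t + 1) n * f n + Smass μ m n (t + 1) (n + 1) * f (n + 1) := by
  have h1 : ∑ x ∈ Finset.Icc m (n + 1), Smass μ m n (t + 1) x * f x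
      = Smass μ m n (t + 1) m * f m + ∑ y ∈ Finset.Ioo m n, Smass μ m n (t + 1) y * f y
        + Smass μ m n (t + 1) n * f n + Smass μ m n (t + 1) (n + 1) * f (n + 1) := by
    rw [Finset.sum_Icc_succ_top (by omega), ← Finset.sum_Ioc_add_eq_sum_Icc hmn.le,
      ← Finset.sum_Ioo_add_eq_sum_Ioc hmn]
    ring
  rw [← h1]
  have h2 : ∀ x ∈ Finset.Icc m (n + 1), Smass μ m n (t + 1) x * f x
      = ∑ y ∈ Finset.Ioo m n, Smass μ m n t y * (transY q p1 p2 y x * f x) := by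
    intro x _
    rw [Smass_succ μ _ init hμ m n t x (fun y hy => by
      rw [Finset.mem_Ioo] at hy
      exact transY_nonneg q p1 p2 hq hp1 hp2 y x (by omega)), Finset.sum_mul]
    refine Finset.sum_congr rfl fun y _ => by ring
  rw [Finset.sum_congr rfl h2, Finset.sum_comm]
  refine Finset.sum_congr rfl fun y hy => ?_
  rw [Finset.mem_Ioo] at hy
  rw [← Finset.mul_sum, transY_sum q p1 p2 m n y (by omega) hy.1 hy.2]

/-- Solution of `f x = P f x + c`, written from the left boundary. -/
def hseq (q p1 p2 : ℕ → ℝ) (m : ℕ) (c h1 h2 : ℝ) : ℕ → ℝ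
  | 0 => 0
  | 1 => h1
  | 2 => h2
  | j + 3 => (hseq q p1 p2 m c h1 h2 (j + 1) - q (m + j + 1) * hseq q p1 p2 m c h1 h2 j
      - p1 (m + j + 1) * hseq q p1 p2 m c h1 h2 (j + 2) - c) / p2 (m + j + 1)

lemma hseq_harm (q p1 p2 : ℕ → ℝ) (hp2 : ∀ k, 2 ≤ k → 0 < p2 k) (m : ℕ) (hm : 1 ≤ m)
    (c h1 h2 : ℝ) (x : ℕ) (hx : m < x) :
    hseq q p1 p2 m c h1 h2 (x - m) = q x * hseq q p1 p2 m c h1 h2 (x - 1 - m)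
      + p1 x * hseq q p1 p2 m c h1 h2 (x + 1 - m)
      + p2 x * hseq q p1 p2 m c h1 h2 (x + 2 - m) + c := by
  obtain ⟨j, rfl⟩ : ∃ j, x = m + j + 1 := ⟨x - m - 1, by omega⟩
  rw [show m + j + 1 - m = j + 1 by omega, show m + j + 1 - 1 - m = j by omega,
    show m + j + 1 + 1 - m = j + 2 by omega, show m + j + 1 + 2 - m = j + 3 by omega]
  have := hp2 (m + j + 1) (by omega)
  rw [hseq.eq_4]
  field_simp
  ring

lemma Smass_tendsto (q p1 p2 : ℕ → ℝ)
    (hq : ∀ k, 2 ≤ k → 0 < q k) (hp1 : ∀ k, 2 ≤ k → 0 ≤ p1 k)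
    (hp2 : ∀ k, 2 ≤ k → 0 < p2 k)
    (hsum : ∀ k, 2 ≤ k → q k + p1 k + p2 k = 1)
    (μ : Measure (ℕ → ℕ)) [IsProbabilityMeasure μ] (init : ℕ)
    (hμ : IsMarkovChain μ (transY q p1 p2) init) (m n : ℕ) (hm : 1 ≤ m) (hmn : m < n)
    (y : ℕ) (hy : y ∈ Finset.Ioo m n) :
    Tendsto (fun t => Smass μ m n t y) atTop (𝓝 0) := by
  set φ0 : ℕ → ℝ := fun x => hseq q p1 p2 m 1 0 0 (x - m) with hφ0
  set C : ℝ := ∑ x ∈ Finset.range (n + 2), |φ0 x| with hC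
  set φ : ℕ → ℝ := fun x => φ0 x + C with hφ
  have hpos : ∀ x, x ≤ n + 1 → 0 ≤ φ x := by
    intro x hx
    have h1 : |φ0 x| ≤ C := Finset.single_le_sum (f := fun x => |φ0 x|)
      (fun i _ => abs_nonneg _) (by simp; omega)
    have := neg_abs_le (φ0 x)
    simp only [hφ]; linarith
  have hstep : ∀ x ∈ Finset.Ioo m n,
      q x * φ (x - 1) + p1 x * φ (x + 1) + p2 x * φ (x + 2) = φ x - 1 := by
    intro x hx
    rw [Finset.mem_Ioo] at hx
    have h1 := hseq_harm q p1 p2 hp2 m hm 1 0 0 x hx.1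
    have h2 := hsum x (by omega)
    simp only [hφ, hφ0]
    linear_combination C * h2 - h1
  set Φ : ℕ → ℝ := fun t => ∑ y ∈ Finset.Ioo m n, Smass μ m n t y * φ y with hΦ
  set M : ℕ → ℝ := fun t => ∑ y ∈ Finset.Ioo m n, Smass μ m n t y with hM
  have hM0 : ∀ t, 0 ≤ M t := fun t => Finset.sum_nonneg fun y _ => Smass_nonneg _ _ _ _ _
  have hrec : ∀ t, Φ (t + 1) + M t ≤ Φ t := by
    intro t
    have h1 := step_id q p1 p2 hq hp1 hp2 μ init hμ m n hm hmn φ t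
    have h2 : ∑ y ∈ Finset.Ioo m n, Smass μ m n t y *
        (q y * φ (y - 1) + p1 y * φ (y + 1) + p2 y * φ (y + 2)) = Φ t - M t := by
      simp only [hΦ, hM]
      rw [← Finset.sum_sub_distrib]
      refine Finset.sum_congr rfl fun y hy => ?_
      rw [hstep y hy]; ring
    rw [h2] at h1
    have a1 := mul_nonneg (Smass_nonneg μ m n (t + 1) m) (hpos m (by omega))
    have a2 := mul_nonneg (Smass_nonneg μ m n (t + 1) n) (hpos n (by omega))
    have a3 := mul_nonneg (Smass_nonneg μ m n (t + 1) (n + 1)) (hpos (n + 1) (by omega))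
    have a4 : Φ (t + 1) = ∑ y ∈ Finset.Ioo m n, Smass μ m n (t + 1) y * φ y := rfl
    linarith
  have hΦ0 : ∀ t, 0 ≤ Φ t := fun t => Finset.sum_nonneg fun y hy =>
    mul_nonneg (Smass_nonneg _ _ _ _ _) (hpos y (by rw [Finset.mem_Ioo] at hy; omega))
  have hb : ∀ T, ∑ t ∈ Finset.range T, M t + Φ T ≤ Φ 0 := by
    intro T
    induction T with
    | zero => simp
    | succ T ih => rw [Finset.sum_range_succ]; linarith [hrec T]
  have hs : Summable M := summable_of_sum_range_le hM0 (c := Φ 0)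
    (fun T => by linarith [hb T, hΦ0 T])
  refine squeeze_zero (fun t => Smass_nonneg _ _ _ _ _) (fun t => ?_) hs.tendsto_atTop_zero
  exact Finset.single_le_sum (f := fun y => Smass μ m n t y)
    (fun y _ => Smass_nonneg _ _ _ _ _) hy

lemma exit_id (q p1 p2 : ℕ → ℝ)
    (hq : ∀ k, 2 ≤ k → 0 < q k) (hp1 : ∀ k, 2 ≤ k → 0 ≤ p1 k)
    (hp2 : ∀ k, 2 ≤ k → 0 < p2 k)
    (hsum : ∀ k, 2 ≤ k → q k + p1 k + p2 k = 1)
    (μ : ℕ → Measure (ℕ → ℕ)) (hprob : ∀ x, IsProbabilityMeasure (μ x))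
    (hμ : ∀ x, IsMarkovChain (μ x) (transY q p1 p2) x) (m n : ℕ) (hm : 1 ≤ m) (hmn : m + 2 ≤ n)
    (f : ℕ → ℝ) (hf0 : f m = 0)
    (hf : ∀ x ∈ Finset.Ioo m n,
      f x = q x * f (x - 1) + p1 x * f (x + 1) + p2 x * f (x + 2)) :
    f (m + 1) = (QY μ (m + 1) n m n).toReal * f n
      + (QY μ (m + 1) (n + 1) m n).toReal * f (n + 1) := by
  have := hprob (m + 1)
  set ν := μ (m + 1) with hν
  have hνm := hμ (m + 1)
  rw [← hν] at hνm
  have hs1 : HasSum (fun t => Smass ν m n t n) (QY μ (m + 1) n m n).toReal :=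
    Q_hasSum ν m n n le_rfl
  have hs2 : HasSum (fun t => Smass ν m n t (n + 1)) (QY μ (m + 1) (n + 1) m n).toReal :=
    Q_hasSum ν m n (n + 1) (by omega)
  have hS0 : ∀ x, Smass ν m n 0 x = if x = m + 1 then 1 else 0 := by
    intro x
    have e : {ω : ℕ → ℕ | (∀ i < 0, m < ω i ∧ ω i < n) ∧ ω 0 = x} = {ω | ω 0 = x} := by
      ext ω; simp
    rw [Smass, e]
    split_ifs with hx
    · rw [hx, hνm.1]; simp
    · have h0 : ν {ω | ω 0 = m + 1}ᶜ = 0 := by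
        rw [prob_compl_eq_zero_iff]
        · exact hνm.1
        · exact measurableSet_eq_fun (measurable_pi_apply 0) measurable_const
      have : ν {ω | ω 0 = x} = 0 := by
        refine measure_mono_null ?_ h0
        intro ω hω
        simp only [Set.mem_ofPred_eq, Set.mem_compl_iff] at *
        omega
      rw [this]; simp
  set H : ℕ → ℝ := fun t => ∑ y ∈ Finset.Ioo m n, Smass ν m n t y * f y with hH
  have hH0 : H 0 = f (m + 1) := by
    simp only [hH, hS0, ite_mul, one_mul, zero_mul, Finset.sum_ite_eq']
    rw [if_pos (by simp; omega)]
  have hrec : ∀ t, H t = H (t + 1) + Smass ν m n (t + 1) n * f n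
      + Smass ν m n (t + 1) (n + 1) * f (n + 1) := by
    intro t
    have h1 := step_id q p1 p2 hq hp1 hp2 ν (m + 1) hνm m n hm (by omega) f t
    rw [hf0, mul_zero, zero_add] at h1
    simp only [hH]
    rw [← h1]
    exact Finset.sum_congr rfl fun y hy => by rw [← hf y hy]
  have hpart : ∀ T, f (m + 1) = H T + (∑ t ∈ Finset.range (T + 1), Smass ν m n t n) * f n
      + (∑ t ∈ Finset.range (T + 1), Smass ν m n t (n + 1)) * f (n + 1) := by
    intro T
    induction T with
    | zero =>
      simp only [zero_add, Finset.sum_range_one, hS0, hH0]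
      rw [if_neg (by omega), if_neg (by omega)]; ring
    | succ T ih =>
      rw [Finset.sum_range_succ _ (T + 1), Finset.sum_range_succ _ (T + 1)]
      rw [ih, hrec T]; ring
  have hHl : Tendsto H atTop (𝓝 0) := by
    have : Tendsto H atTop (𝓝 (∑ y ∈ Finset.Ioo m n, 0 * f y)) :=
      tendsto_finsetSum _ fun y hy =>
        (Smass_tendsto q p1 p2 hq hp1 hp2 hsum ν (m + 1) hνm m n hm (by omega) y hy).mul_const _
    simpa using this
  have hlim := (hHl.add ((hs1.tendsto_sum_nat.comp (tendsto_add_atTop_nat 1)).mul_const (f n))).add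
    ((hs2.tendsto_sum_nat.comp (tendsto_add_atTop_nat 1)).mul_const (f (n + 1)))
  have hc : Tendsto (fun _ : ℕ => f (m + 1)) atTop (𝓝 (f (m + 1))) := tendsto_const_nhds
  have := tendsto_nhds_unique hc (hlim.congr fun T => (hpart T).symm)
  rw [this]; ring

/-- algebra of the harmonic function -/
lemma hseq_alg (q p1 p2 : ℕ → ℝ)
    (hq : ∀ k, 2 ≤ k → 0 < q k) (hp1 : ∀ k, 2 ≤ k → 0 ≤ p1 k)
    (hp2 : ∀ k, 2 ≤ k → 0 < p2 k)
    (hsum : ∀ k, 2 ≤ k → q k + p1 k + p2 k = 1) (A B : ℕ → ℝ)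
    (hA : A = fun k => (p1 k + p2 k) / q k) (hB : B = fun k => p2 k / q k)
    (m : ℕ) (hm : 1 ≤ m) (h : ℕ → ℝ) (hh : h = hseq q p1 p2 m 0 0 1) (j : ℕ) :
    (h (j + 1) - h j = - ys A B m j * (h (j + 2) - h (j + 1)) ∧ h (j + 2) - h (j + 1) ≠ 0)
      ∧ h (j + 1) = ws A B m j * (h (j + 1) - h j) := by
  have hB0 : ∀ k, 2 ≤ k → 0 < B k := fun k hk => by
    rw [hB]; exact div_pos (hp2 k hk) (hq k hk)
  have hAB : ∀ k, 2 ≤ k → B k ≤ A k := fun k hk => by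
    rw [hB, hA]
    have := hp1 k hk
    have := hq k hk
    simp only
    gcongr; linarith
  induction j with
  | zero => simp [hh, hseq, ys, ws]
  | succ j ih =>
    obtain ⟨⟨h1, h2⟩, h3⟩ := ih
    have hy := (ys_mem A B m hm hB0 hAB j).1
    have hb := hB0 (m + j + 1) (by omega)
    have ha := hAB (m + j + 1) (by omega)
    have hrec : h (j + 1) - h j = A (m + j + 1) * (h (j + 2) - h (j + 1))
        + B (m + j + 1) * (h (j + 3) - h (j + 2)) := by
      have e := hseq_harm q p1 p2 hp2 m hm 0 0 1 (m + j + 1) (by omega)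
      rw [show m + j + 1 - m = j + 1 by omega, show m + j + 1 - 1 - m = j by omega,
        show m + j + 1 + 1 - m = j + 2 by omega, show m + j + 1 + 2 - m = j + 3 by omega,
        ← hh] at e
      have e2 := hsum (m + j + 1) (by omega)
      have e3 := hq (m + j + 1) (by omega)
      rw [hA, hB]
      field_simp
      linear_combination e + h (j + 1) * e2
    have hsp : 0 < A (m + j + 1) + ys A B m j := by linarith
    have hys : ys A B m (j + 1) * (A (m + j + 1) + ys A B m j) = B (m + j + 1) := by
      rw [ys, div_mul_cancel₀ _ hsp.ne']
    have k1 : B (m + j + 1) * (h (j + 3) - h (j + 2))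
        = - (A (m + j + 1) + ys A B m j) * (h (j + 2) - h (j + 1)) := by
      linear_combination h1 - hrec
    refine ⟨⟨?_, ?_⟩, ?_⟩
    · apply mul_left_cancel₀ hsp.ne'
      linear_combination k1 + (h (j + 3) - h (j + 2)) * hys
    · intro h0
      change h (j + 3) - h (j + 2) = 0 at h0
      rw [h0, mul_zero] at k1
      have := mul_ne_zero (neg_ne_zero.2 hsp.ne') h2
      exact this k1.symm
    · change h (j + 2) = _ * (h (j + 2) - h (j + 1))
      rw [ws]
      linear_combination h3 + ws A B m j * h1

theorem Q_ratio_uniform_limit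
    (q p1 p2 : ℕ → ℝ)
    (hq : ∀ k, 2 ≤ k → 0 < q k) (hp1 : ∀ k, 2 ≤ k → 0 ≤ p1 k)
    (hp2 : ∀ k, 2 ≤ k → 0 < p2 k)
    (hsum : ∀ k, 2 ≤ k → q k + p1 k + p2 k = 1)
    (μ : ℕ → Measure (ℕ → ℕ)) (hprob : ∀ x, IsProbabilityMeasure (μ x))
    (hμ : ∀ x, IsMarkovChain (μ x) (transY q p1 p2) x)
    (a b : ℝ) (ha : 0 < a) (hb : 0 < b)
    (hCa : Tendsto (fun k => (p1 k + p2 k) / q k) atTop (𝓝 a))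
    (hCb : Tendsto (fun k => p2 k / q k) atTop (𝓝 b))
    (σ : ℝ) (hσ : σ = (a - Real.sqrt (a ^ 2 + 4 * b)) / 2) :
    ∀ ε : ℝ, 0 < ε → ∃ N : ℕ, ∀ n, N ≤ n → ∀ k : ℕ, 1 ≤ k →
      |(QY μ (k + 1) (k + n) k (k + n)).toReal
          / (QY μ (k + 1) (k + n + 1) k (k + n)).toReal + σ⁻¹| < ε := by
  set A : ℕ → ℝ := fun k => (p1 k + p2 k) / q k with hA
  set B : ℕ → ℝ := fun k => p2 k / q k with hB
  have hB0 : ∀ k, 2 ≤ k → 0 < B k := fun k hk => div_pos (hp2 k hk) (hq k hk)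
  have hAB : ∀ k, 2 ≤ k → B k ≤ A k := fun k hk => by
    have := hp1 k hk
    have := hq k hk
    simp only [hA, hB]
    gcongr; linarith
  have hba : b ≤ a := le_of_tendsto_of_tendsto hCb hCa
    (eventually_atTop.2 ⟨2, fun k hk => hAB k hk⟩)
  set y : ℝ := -σ with hy
  have hr := Real.sq_sqrt (show 0 ≤ a ^ 2 + 4 * b by positivity)
  have hr0 := Real.sqrt_nonneg (a ^ 2 + 4 * b)
  have hyb : y * (a + y) = b := by
    rw [hy, hσ]; linear_combination hr / 4
  have hy0 : 0 < y := by
    rw [hy, hσ]; nlinarith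
  have hy1 : y < 1 := by nlinarith
  have hY := ys_lim A B a b y ha hb hy0 hB0 hAB hyb hCa hCb
  have hW := ws_lim A B y hy0 hy1 hB0 hAB hY
  have hw0 : 0 < 1 / (1 + y) := by positivity
  have hY1 : Tendsto (fun x : ℕ × ℕ => ys A B (x.1 + 1) (x.2 + 1)) UF (𝓝 y) :=
    hY.comp (uf_shift 1)
  have hW1 : Tendsto (fun x : ℕ × ℕ => ws A B (x.1 + 1) (x.2 + 1)) UF (𝓝 (1 / (1 + y))) :=
    hW.comp (uf_shift 1)
  have hW2 : Tendsto (fun x : ℕ × ℕ => ws A B (x.1 + 1) (x.2 + 2)) UF (𝓝 (1 / (1 + y))) :=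
    hW.comp (uf_shift 2)
  have hlim := hW2.div (hW1.mul hY1) (mul_pos hw0 hy0).ne'
  have hval : 1 / (1 + y) / (1 / (1 + y) * y) = - σ⁻¹ := by
    have : σ = -y := by rw [hy]; ring
    rw [this]; field_simp
  rw [hval] at hlim
  intro ε hε
  obtain ⟨N, hN⟩ := uf_ev.1 (((Metric.tendsto_nhds.1 hlim ε hε).and
    (hW1.eventually (lt_mem_nhds hw0))).and (hY1.eventually (lt_mem_nhds hy0)))
  refine ⟨N + 2, fun n hn k hk => ?_⟩
  obtain ⟨⟨h1, h2⟩, h3⟩ := hN (n - 2) (by omega) (k - 1)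
  simp only [Pi.div_apply, Nat.sub_add_cancel hk] at h1 h2 h3
  obtain ⟨j, rfl⟩ : ∃ j, n = j + 2 := ⟨n - 2, by omega⟩
  rw [show j + 2 - 2 = j by omega] at h1 h2 h3
  have ex : ∀ u v : ℝ, u = (QY μ (k + 1) (k + (j + 2)) k (k + (j + 2))).toReal
        * hseq q p1 p2 k 0 u v (j + 2)
      + (QY μ (k + 1) (k + (j + 2) + 1) k (k + (j + 2))).toReal
        * hseq q p1 p2 k 0 u v (j + 3) := by
    intro u v
    have := exit_id q p1 p2 hq hp1 hp2 hsum μ hprob hμ k (k + (j + 2)) hk (by omega)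
      (fun x => hseq q p1 p2 k 0 u v (x - k)) (by simp [hseq])
      (fun x hx => by
        have := hseq_harm q p1 p2 hp2 k hk 0 u v x (Finset.mem_Ioo.1 hx).1
        rw [add_zero] at this
        exact this)
    rw [show k + 1 - k = 1 by omega, show k + (j + 2) - k = j + 2 by omega,
      show k + (j + 2) + 1 - k = j + 3 by omega] at this
    rw [hseq] at this
    exact this
  have e0 := ex 0 1
  have e1 := ex 1 0
  generalize (QY μ (k + 1) (k + (j + 2)) k (k + (j + 2))).toReal = Q at *
  generalize (QY μ (k + 1) (k + (j + 2) + 1) k (k + (j + 2))).toReal = R at *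
  obtain ⟨⟨g1, g2⟩, g3⟩ := hseq_alg q p1 p2 hq hp1 hp2 hsum A B hA hB k hk _ rfl (j + 1)
  obtain ⟨_, g4⟩ := hseq_alg q p1 p2 hq hp1 hp2 hsum A B hA hB k hk _ rfl (j + 2)
  simp only [add_assoc, Nat.reduceAdd] at g1 g2 g3 g4
  generalize hseq q p1 p2 k 0 0 1 (j + 3) = z3 at *
  generalize hseq q p1 p2 k 0 0 1 (j + 2) = z2 at *
  generalize hseq q p1 p2 k 0 0 1 (j + 1) = z1 at *
  generalize ws A B k (j + 2) = w2 at *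
  generalize ws A B k (j + 1) = w1 at *
  generalize ys A B k (j + 1) = y1 at *
  have key : Q * (w1 * y1) = R * w2 := by
    apply mul_right_cancel₀ g2
    linear_combination e0 + Q * g3 + R * g4 + Q * w1 * g1
  have hR : R ≠ 0 := by
    intro hR
    rw [hR, zero_mul] at key
    have hQ : Q = 0 := by
      rcases mul_eq_zero.1 key with h | h
      · exact h
      · exact absurd h (mul_pos h2 h3).ne'
    rw [hR, hQ] at e1
    simp at e1
  have : Q / R = w2 / (w1 * y1) := by
    rw [div_eq_div_iff hR (mul_pos h2 h3).ne']
    linear_combination key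
  rw [this]
  rw [Real.dist_eq, sub_neg_eq_add] at h1
  exact h1

end
end

section
/- Let C = {k ≥ 0 : k is a cutpoint of X}, where k is a cutpoint of X if #{n ≥ 0 : X_n = k} = 1. Then for every k ≥ 2, P(k ∈ C) = q_k / F_X(k), and for all 2 ≤ j < k, P(j ∈ C and k ∈ C) = q_j q_k / (F_X(j,k) F_X(k)) (with the convention 1/∞ = 0 when F_X(k) = ∞). -/
open Filter MeasureTheory ENNReal Topology

noncomputable section

/-- Transition function of the (2,1) random walk `X`. -/
def transX (q p1 p2 : ℕ → ℝ) (n j : ℕ) : ℝ :=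
  if n = 0 then (if j = 1 then 1 else 0)
  else if n = 1 then (if j = 2 then 1 else 0)
  else if j = n + 1 then q n
  else if j = n - 1 then p1 n
  else if j = n - 2 then p2 n
  else 0

/-- The matrix `A_k` with first row `(a_k, b_k)` and second row `(1, 0)`. -/
def Amat (q p1 p2 : ℕ → ℝ) (k : ℕ) : Matrix (Fin 2) (Fin 2) ℝ :=
  !![(p1 k + p2 k) / q k, p2 k / q k; 1, 0]

/-- The ordered product `A_s A_{s-1} ⋯ A_{m+1}`, indices decreasing from `s`
down to `m+1` (identity when `s ≤ m`). -/
def prodDesc (q p1 p2 : ℕ → ℝ) (s m : ℕ) : Matrix (Fin 2) (Fin 2) ℝ :=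
  ((List.range (s - m)).map fun i => Amat q p1 p2 (s - i)).prod

/-- `F_X(m,n) = 1 + Σ_{s=m+1}^{n-1} e₁ A_s ⋯ A_{m+1} e₁ᵗ`. -/
def FXfin (q p1 p2 : ℕ → ℝ) (m n : ℕ) : ℝ :=
  1 + ∑ s ∈ Finset.Icc (m + 1) (n - 1), prodDesc q p1 p2 s m 0 0

/-- `F_X(m) = lim_{n→∞} F_X(m,n) = 1 + Σ_{s=m+1}^∞ e₁ A_s ⋯ A_{m+1} e₁ᵗ ∈ (0,∞]`. -/
def FXinf (q p1 p2 : ℕ → ℝ) (m : ℕ) : ℝ≥0∞ :=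
  1 + ∑' j : ℕ, ENNReal.ofReal (prodDesc q p1 p2 (m + 1 + j) m 0 0)

/-! ### One-step operator -/

/-- One-step expectation operator of the walk. -/
def stepOp (q p1 p2 : ℕ → ℝ) (f : ℕ → ℝ) (x : ℕ) : ℝ :=
  ∑ y ∈ Finset.range (x + 2), transX q p1 p2 x y * f y

theorem stepOp_zero (q p1 p2 f : ℕ → ℝ) : stepOp q p1 p2 f 0 = f 1 := by
  simp [stepOp, Finset.sum_range_succ, transX]

theorem stepOp_one (q p1 p2 f : ℕ → ℝ) : stepOp q p1 p2 f 1 = f 2 := by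
  simp [stepOp, Finset.sum_range_succ, transX]

theorem stepOp_two (q p1 p2 f : ℕ → ℝ) (n : ℕ) :
    stepOp q p1 p2 f (n + 2) = q (n + 2) * f (n + 3) + p1 (n + 2) * f (n + 1)
      + p2 (n + 2) * f n := by
  unfold stepOp
  rw [Finset.sum_range_succ, Finset.sum_range_succ, Finset.sum_range_succ, Finset.sum_range_succ,
    Finset.sum_eq_zero]
  · have e1 : transX q p1 p2 (n + 2) n = p2 (n + 2) := by
      simp only [transX]; split_ifs <;> first | contradiction | omega | rfl
    have e2 : transX q p1 p2 (n + 2) (n + 1) = p1 (n + 2) := by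
      simp only [transX]; split_ifs <;> first | contradiction | omega | rfl
    have e3 : transX q p1 p2 (n + 2) (n + 2) = 0 := by
      simp only [transX]; split_ifs <;> first | contradiction | omega | rfl
    have e4 : transX q p1 p2 (n + 2) (n + 2 + 1) = q (n + 2) := by
      simp only [transX]; split_ifs <;> first | contradiction | omega | rfl
    rw [e1, e2, e3, e4]
    ring
  · intro y hy
    have hy := Finset.mem_range.1 hy
    have : transX q p1 p2 (n + 2) y = 0 := by
      simp only [transX]; split_ifs <;> first | contradiction | omega | rfl
    rw [this, zero_mul]

theorem transX_eq_zero (q p1 p2 : ℕ → ℝ) (x y : ℕ) (h : x + 2 ≤ y) :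
    transX q p1 p2 x y = 0 := by
  simp only [transX]; split_ifs <;> first | contradiction | omega | rfl

theorem stepOp_congr (q p1 p2 f g : ℕ → ℝ) (x : ℕ) (h : ∀ y ≤ x + 1, f y = g y) :
    stepOp q p1 p2 f x = stepOp q p1 p2 g x := by
  unfold stepOp
  refine Finset.sum_congr rfl fun y hy => ?_
  rw [h y (by have := Finset.mem_range.1 hy; omega)]

theorem stepOp_sub (q p1 p2 f g : ℕ → ℝ) (x : ℕ) :
    stepOp q p1 p2 (fun y => f y - g y) x = stepOp q p1 p2 f x - stepOp q p1 p2 g x := by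
  simp [stepOp, mul_sub, Finset.sum_sub_distrib]

theorem stepOp_mul (q p1 p2 f : ℕ → ℝ) (c : ℝ) (x : ℕ) :
    stepOp q p1 p2 (fun y => f y * c) x = stepOp q p1 p2 f x * c := by
  simp [stepOp, Finset.sum_mul, mul_assoc]

/-- Hypotheses on the parameters. -/
structure Good (q p1 p2 : ℕ → ℝ) : Prop where
  hq : ∀ k, 2 ≤ k → 0 < q k
  hp1 : ∀ k, 2 ≤ k → 0 ≤ p1 k
  hp2 : ∀ k, 2 ≤ k → 0 < p2 k
  hsum : ∀ k, 2 ≤ k → q k + p1 k + p2 k = 1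

theorem transX_nonneg {q p1 p2 : ℕ → ℝ} (H : Good q p1 p2) (x y : ℕ) :
    0 ≤ transX q p1 p2 x y := by
  unfold transX
  split_ifs
  all_goals first
    | exact zero_le_one
    | exact le_rfl
    | exact (H.hq x (by omega)).le
    | exact H.hp1 x (by omega)
    | exact (H.hp2 x (by omega)).le

theorem stepOp_const {q p1 p2 : ℕ → ℝ} (H : Good q p1 p2) (c : ℝ) (x : ℕ) :
    stepOp q p1 p2 (fun _ => c) x = c := by
  match x with
  | 0 => rw [stepOp_zero]
  | 1 => rw [stepOp_one]
  | n + 2 =>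
    rw [stepOp_two]
    have := H.hsum (n + 2) (by omega)
    linear_combination c * this

theorem stepOp_mono {q p1 p2 : ℕ → ℝ} (H : Good q p1 p2) {f g : ℕ → ℝ} (h : ∀ y, f y ≤ g y)
    (x : ℕ) : stepOp q p1 p2 f x ≤ stepOp q p1 p2 g x :=
  Finset.sum_le_sum fun y _ => mul_le_mul_of_nonneg_left (h y) (transX_nonneg H x y)

/-- Maximum principle on `[0,N]`. -/
theorem max_principle {q p1 p2 : ℕ → ℝ} (H : Good q p1 p2) (N : ℕ) (S : Finset ℕ) (g : ℕ → ℝ)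
    (hg : ∀ x < N, x ∉ S → g x = stepOp q p1 p2 g x) (hS : ∀ x ∈ S, x ≤ N → g x ≤ 0)
    (hN : g N ≤ 0) : ∀ x ≤ N, g x ≤ 0 := by
  by_contra! hcon
  obtain ⟨x0, hx0, hpos⟩ := hcon
  obtain ⟨z, hz, hzmax⟩ := Finset.exists_max_image (Finset.range (N + 1)) g
    ⟨0, by simp⟩
  have hgz : 0 < g z := lt_of_lt_of_le hpos (hzmax x0 (by simp; omega))
  obtain ⟨x, hx, hxmax⟩ := Finset.exists_max_image
    ((Finset.range (N + 1)).filter fun y => g y = g z) id ⟨z, by simp [hz]⟩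
  rw [Finset.mem_filter, Finset.mem_range] at hx
  have hle : ∀ y ≤ N, g y ≤ g x := fun y hy => hx.2 ▸ hzmax y (by simp; omega)
  have hxpos : 0 < g x := hx.2 ▸ hgz
  have hxN : x < N := by
    rcases Nat.lt_or_ge x N with h | h
    · exact h
    · have : x = N := by omega
      subst this; linarith
  have hxS : x ∉ S := fun h => by have := hS x h hxN.le; linarith
  have hlt : ∀ y ≤ N, x < y → g y < g x := by
    intro y hy hxy
    refine lt_of_le_of_ne (hle y hy) fun he => ?_
    have := hxmax y (by simp [he, hx.2]; omega)
    simp at this; omega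
  have e := hg x hxN hxS
  have h1 := hlt (x + 1) (by omega) (by omega)
  match x, e, h1, hxN, hle with
  | 0, e, h1, hxN, hle => rw [stepOp_zero] at e; simp at h1; linarith
  | 1, e, h1, hxN, hle => rw [stepOp_one] at e; norm_num at h1; linarith
  | n + 2, e, h1, hxN, hle =>
    rw [stepOp_two] at e
    have := H.hsum (n + 2) (by omega)
    have a := mul_lt_mul_of_pos_left h1 (H.hq (n + 2) (by omega))
    have b := mul_le_mul_of_nonneg_left (hle (n + 1) (by omega)) (H.hp1 (n + 2) (by omega))
    have c := mul_le_mul_of_nonneg_left (hle n (by omega)) (H.hp2 (n + 2) (by omega)).le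
    have d : g (n + 2) = q (n + 2) * g (n + 2) + p1 (n + 2) * g (n + 2) + p2 (n + 2) * g (n + 2) := by
      linear_combination -(g (n + 2)) * this
    have h3 : n + 2 + 1 = n + 3 := rfl
    rw [h3] at a
    linarith

/-- Uniqueness on `[0,N]`. -/
theorem uniq {q p1 p2 : ℕ → ℝ} (H : Good q p1 p2) (N : ℕ) (S : Finset ℕ) (f g : ℕ → ℝ)
    (hf : ∀ x < N, x ∉ S → f x = stepOp q p1 p2 f x)
    (hg : ∀ x < N, x ∉ S → g x = stepOp q p1 p2 g x)
    (hS : ∀ x ∈ S, x ≤ N → f x = g x) (hN : f N = g N) : ∀ x ≤ N, f x = g x := by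
  intro x hx
  apply le_antisymm
  · have := max_principle H N S (fun y => f y - g y)
      (fun x h1 h2 => by simp only [stepOp_sub]; rw [← hf x h1 h2, ← hg x h1 h2])
      (fun x h1 h2 => by simp [hS x h1 h2]) (by simp [hN]) x hx
    simpa using this
  · have := max_principle H N S (fun y => g y - f y)
      (fun x h1 h2 => by simp only [stepOp_sub]; rw [← hf x h1 h2, ← hg x h1 h2])
      (fun x h1 h2 => by simp [hS x h1 h2]) (by simp [hN]) x hx
    simpa using this

/-! ### Finite-horizon dynamic programming -/

/-- Update of the forbidden set. -/
def updS (S T : Finset ℕ) (x : ℕ) : Finset ℕ := if x ∈ T then insert x S else S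

/-- Probability, from `x`, of avoiding `S` and visiting each point of `T` at most once
up to time `t`. -/
def Mfin (q p1 p2 : ℕ → ℝ) (T : Finset ℕ) : ℕ → Finset ℕ → ℕ → ℝ
  | 0, S, x => if x ∈ S then 0 else 1
  | t + 1, S, x => if x ∈ S then 0 else stepOp q p1 p2 (Mfin q p1 p2 T t (updS S T x)) x

theorem Mfin_nonneg {q p1 p2 : ℕ → ℝ} (H : Good q p1 p2) (T : Finset ℕ) (t : ℕ) :
    ∀ S x, 0 ≤ Mfin q p1 p2 T t S x := by
  induction t with
  | zero => intro S x; simp only [Mfin]; split_ifs <;> norm_num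
  | succ t ih =>
    intro S x; simp only [Mfin]; split_ifs
    · exact le_rfl
    · exact Finset.sum_nonneg fun y _ => mul_nonneg (transX_nonneg H x y) (ih _ _)

theorem Mfin_anti_succ {q p1 p2 : ℕ → ℝ} (H : Good q p1 p2) (T : Finset ℕ) (t : ℕ) :
    ∀ S x, Mfin q p1 p2 T (t + 1) S x ≤ Mfin q p1 p2 T t S x := by
  induction t with
  | zero =>
    intro S x; simp only [Mfin]; split_ifs
    · exact le_rfl
    · calc _ ≤ stepOp q p1 p2 (fun _ => 1) x :=
            stepOp_mono H (fun y => by split_ifs <;> norm_num) x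
        _ = 1 := stepOp_const H 1 x
  | succ t ih =>
    intro S x
    rw [Mfin, Mfin]
    split_ifs
    · exact le_rfl
    · exact stepOp_mono H (fun y => ih _ y) x

/-- Infinite-horizon limit. -/
def Minf (q p1 p2 : ℕ → ℝ) (T S : Finset ℕ) (x : ℕ) : ℝ := ⨅ t, Mfin q p1 p2 T t S x

theorem Mfin_tendsto {q p1 p2 : ℕ → ℝ} (H : Good q p1 p2) (T S : Finset ℕ) (x : ℕ) :
    Tendsto (fun t => Mfin q p1 p2 T t S x) atTop (𝓝 (Minf q p1 p2 T S x)) :=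
  tendsto_atTop_ciInf (antitone_nat_of_succ_le fun t => Mfin_anti_succ H T t S x)
    ⟨0, by rintro _ ⟨t, rfl⟩; exact Mfin_nonneg H T t S x⟩

theorem Minf_mem {q p1 p2 : ℕ → ℝ} (T S : Finset ℕ) (x : ℕ) (hx : x ∈ S) :
    Minf q p1 p2 T S x = 0 := by
  have : ∀ t, Mfin q p1 p2 T t S x = 0 := by
    intro t; cases t <;> simp [Mfin, hx]
  simp [Minf, this]

theorem Minf_step {q p1 p2 : ℕ → ℝ} (H : Good q p1 p2) (T S : Finset ℕ) (x : ℕ) (hx : x ∉ S) :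
    Minf q p1 p2 T S x = stepOp q p1 p2 (Minf q p1 p2 T (updS S T x)) x := by
  refine tendsto_nhds_unique ((tendsto_add_atTop_iff_nat 1).2 (Mfin_tendsto H T S x)) ?_
  simp only [Mfin, hx, if_false]
  unfold stepOp
  exact tendsto_finsetSum _ fun y _ => (Mfin_tendsto H T _ y).const_mul _

theorem Minf_le_one {q p1 p2 : ℕ → ℝ} (H : Good q p1 p2) (T S : Finset ℕ) (x : ℕ) :
    Minf q p1 p2 T S x ≤ 1 := by
  refine (ciInf_le ⟨0, by rintro _ ⟨t, rfl⟩; exact Mfin_nonneg H T t S x⟩ 0).trans ?_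
  simp only [Mfin]; split_ifs <;> norm_num

/-! ### The harmonic function -/

/-- Increments. -/
def dd (q p1 p2 : ℕ → ℝ) (m s : ℕ) : ℝ := if s < m then 0 else prodDesc q p1 p2 s m 0 0

/-- Harmonic function. -/
def hh (q p1 p2 : ℕ → ℝ) (m x : ℕ) : ℝ := ∑ s ∈ Finset.range x, dd q p1 p2 m s

theorem prodDesc_succ (q p1 p2 : ℕ → ℝ) (s m : ℕ) (h : m ≤ s) :
    prodDesc q p1 p2 (s + 1) m = Amat q p1 p2 (s + 1) * prodDesc q p1 p2 s m := by
  unfold prodDesc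
  rw [show s + 1 - m = (s - m) + 1 by omega, List.range_succ_eq_map, List.map_cons,
    List.prod_cons, List.map_map]
  congr 2
  apply List.map_congr_left
  intro i _
  simp

theorem prodDesc_self (q p1 p2 : ℕ → ℝ) (m : ℕ) : prodDesc q p1 p2 m m = 1 := by
  simp [prodDesc]

theorem dd_self (q p1 p2 : ℕ → ℝ) (m : ℕ) : dd q p1 p2 m m = 1 := by
  simp [dd, prodDesc_self]

theorem prodDesc_one_zero (q p1 p2 : ℕ → ℝ) (s m : ℕ) (h : m ≤ s + 1) :
    prodDesc q p1 p2 (s + 1) m 1 0 = dd q p1 p2 m s := by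
  rcases Nat.lt_or_ge s m with h1 | h1
  · have : m = s + 1 := by omega
    subst this
    simp [prodDesc_self, dd]
  · rw [prodDesc_succ _ _ _ _ _ h1, dd, if_neg (by omega)]
    simp [Amat, Matrix.mul_apply, Fin.sum_univ_two]

theorem dd_rec (q p1 p2 : ℕ → ℝ) (m s : ℕ) (h : m ≤ s + 1) :
    dd q p1 p2 m (s + 2) = (p1 (s + 2) + p2 (s + 2)) / q (s + 2) * dd q p1 p2 m (s + 1)
      + p2 (s + 2) / q (s + 2) * dd q p1 p2 m s := by
  rw [← prodDesc_one_zero _ _ _ _ _ h]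
  rw [dd, if_neg (by omega), prodDesc_succ _ _ _ _ _ (by omega), dd, if_neg (by omega)]
  simp [Amat, Matrix.mul_apply, Fin.sum_univ_two]

theorem dd_nonneg {q p1 p2 : ℕ → ℝ} (H : Good q p1 p2) (m : ℕ) (s : ℕ) : 
    0 ≤ dd q p1 p2 (m + 2) s := by
  induction s using Nat.strong_induction_on with
  | _ s ih =>
    rcases lt_trichotomy s (m + 2) with h | h | h
    · simp [dd, h]
    · subst h; rw [dd_self]; exact zero_le_one
    · obtain ⟨u, rfl⟩ : ∃ u, s = u + 2 := ⟨s - 2, by omega⟩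
      rw [dd_rec _ _ _ _ _ (by omega)]
      have a := H.hq (u + 2) (by omega)
      have b := H.hp1 (u + 2) (by omega)
      have c := H.hp2 (u + 2) (by omega)
      have d := ih u (by omega)
      have e := ih (u + 1) (by omega)
      positivity

theorem hh_zero (q p1 p2 : ℕ → ℝ) (m x : ℕ) (h : x ≤ m) : hh q p1 p2 m x = 0 := by
  unfold hh
  refine Finset.sum_eq_zero fun s hs => ?_
  have := Finset.mem_range.1 hs
  simp [dd]; omega

theorem hh_succ (q p1 p2 : ℕ → ℝ) (m x : ℕ) :
    hh q p1 p2 m (x + 1) = hh q p1 p2 m x + dd q p1 p2 m x := Finset.sum_range_succ _ _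

theorem hh_self_succ (q p1 p2 : ℕ → ℝ) (m : ℕ) : hh q p1 p2 m (m + 1) = 1 := by
  rw [hh_succ, hh_zero _ _ _ _ _ le_rfl, dd_self, zero_add]

theorem hh_mono {q p1 p2 : ℕ → ℝ} (H : Good q p1 p2) (m : ℕ) : Monotone (hh q p1 p2 (m + 2)) :=
  monotone_nat_of_le_succ fun n => by rw [hh_succ]; linarith [dd_nonneg H m n]

theorem hh_pos {q p1 p2 : ℕ → ℝ} (H : Good q p1 p2) (m x : ℕ) (h : m + 2 < x) :
    0 < hh q p1 p2 (m + 2) x :=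
  lt_of_lt_of_le (by rw [hh_self_succ]; exact one_pos) (hh_mono H m (show m + 2 + 1 ≤ x by omega))

theorem hh_harm {q p1 p2 : ℕ → ℝ} (H : Good q p1 p2) (m x : ℕ) (h : x ≠ m + 2) :
    hh q p1 p2 (m + 2) x = stepOp q p1 p2 (hh q p1 p2 (m + 2)) x := by
  rcases Nat.lt_or_ge x (m + 2) with h1 | h1
  · rw [stepOp_congr _ _ _ _ (fun _ => 0) x fun y hy => hh_zero _ _ _ _ _ (by omega),
      stepOp_const H, hh_zero _ _ _ _ _ (by omega)]
  · obtain ⟨n, rfl⟩ : ∃ u, x = u + 2 := ⟨x - 2, by omega⟩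
    rw [stepOp_two]
    have e1 := hh_succ q p1 p2 (m + 2) n
    have e2 := hh_succ q p1 p2 (m + 2) (n + 1)
    have e3 := hh_succ q p1 p2 (m + 2) (n + 2)
    have e4 := dd_rec q p1 p2 (m + 2) n (by omega)
    have a := H.hq (n + 2) (by omega)
    have b := H.hsum (n + 2) (by omega)
    have e5 : q (n + 2) * dd q p1 p2 (m + 2) (n + 2) =
        (p1 (n + 2) + p2 (n + 2)) * dd q p1 p2 (m + 2) (n + 1)
          + p2 (n + 2) * dd q p1 p2 (m + 2) n := by
      rw [e4]; field_simp
    simp only [Nat.add_assoc, Nat.reduceAdd] at e1 e2 e3 e5 ⊢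
    rw [e3, e2, e1]
    rw [show p1 (n + 2) = 1 - q (n + 2) - p2 (n + 2) by linarith] at e5 ⊢
    linear_combination -e5

theorem hh_eq_FXfin (q p1 p2 : ℕ → ℝ) (m n : ℕ) :
    hh q p1 p2 m (m + 1 + n) = 1 + ∑ i ∈ Finset.range n, prodDesc q p1 p2 (m + 1 + i) m 0 0 := by
  induction n with
  | zero => simp [hh_self_succ]
  | succ n ih =>
    rw [← Nat.add_assoc, hh_succ, ih, Finset.sum_range_succ, dd, if_neg (by omega)]
    ring

theorem FXfin_eq (q p1 p2 : ℕ → ℝ) (m n : ℕ) (h : m < n) :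
    FXfin q p1 p2 m n = hh q p1 p2 m n := by
  obtain ⟨u, rfl⟩ : ∃ u, n = m + 1 + u := ⟨n - m - 1, by omega⟩
  rw [hh_eq_FXfin, FXfin]
  congr 1
  have e : Finset.Icc (m + 1) (m + 1 + u - 1) = Finset.Ico (m + 1) (m + 1 + u) := by
    ext z; simp only [Finset.mem_Icc, Finset.mem_Ico]; omega
  rw [e, Finset.sum_Ico_eq_sum_range]
  simp

/-- Reciprocal of `FXinf`. -/
def rr (q p1 p2 : ℕ → ℝ) (m : ℕ) : ℝ := (FXinf q p1 p2 m)⁻¹.toReal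

theorem FXinf_inv (q p1 p2 : ℕ → ℝ) (m : ℕ) :
    (FXinf q p1 p2 m)⁻¹ = ENNReal.ofReal (rr q p1 p2 m) := by
  rw [rr, ENNReal.ofReal_toReal]
  rw [ENNReal.inv_ne_top]
  simp [FXinf]

theorem rr_tendsto {q p1 p2 : ℕ → ℝ} (H : Good q p1 p2) (m : ℕ) :
    Tendsto (fun n => (hh q p1 p2 (m + 2) n)⁻¹) atTop (𝓝 (rr q p1 p2 (m + 2))) := by
  rw [← tendsto_add_atTop_iff_nat (m + 2 + 1)]
  have h1 : Tendsto (fun n => ENNReal.ofReal (hh q p1 p2 (m + 2) (n + (m + 2 + 1)))) atTop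
      (𝓝 (FXinf q p1 p2 (m + 2))) := by
    have := (ENNReal.tendsto_nat_tsum
      (fun j => ENNReal.ofReal (prodDesc q p1 p2 (m + 2 + 1 + j) (m + 2) 0 0))).const_add 1
    refine this.congr fun n => ?_
    have hnn : ∀ i, 0 ≤ prodDesc q p1 p2 (m + 2 + 1 + i) (m + 2) 0 0 := fun i => by
      have := dd_nonneg H m (m + 2 + 1 + i)
      rwa [dd, if_neg (by omega)] at this
    rw [Nat.add_comm n, hh_eq_FXfin, ENNReal.ofReal_add zero_le_one
      (Finset.sum_nonneg fun i _ => hnn i), ENNReal.ofReal_sum_of_nonneg fun i _ => hnn i,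
      ENNReal.ofReal_one]
  have h2 := (ENNReal.tendsto_toReal (a := (FXinf q p1 p2 (m + 2))⁻¹)
    (by rw [FXinf_inv]; exact ENNReal.ofReal_ne_top)).comp (tendsto_inv_iff.2 h1)
  refine h2.congr fun n => ?_
  have := hh_pos H m (n + (m + 2 + 1)) (by omega)
  simp [ENNReal.toReal_inv, ENNReal.toReal_ofReal this.le]

/-! ### Infinite-horizon values -/

theorem updS_of_not_mem (S T : Finset ℕ) (x : ℕ) (h : x ∉ T) : updS S T x = S := by
  simp [updS, h]

theorem updS_of_mem (S T : Finset ℕ) (x : ℕ) (h : x ∈ T) : updS S T x = insert x S := by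
  simp [updS, h]

theorem Minf_avoid {q p1 p2 : ℕ → ℝ} (H : Good q p1 p2) (m : ℕ) (S T : Finset ℕ) (hTS : T ⊆ S)
    (hm : m + 2 ∈ S) (hS : ∀ x ∈ S, x ≤ m + 2) (x : ℕ) :
    Minf q p1 p2 T S x = hh q p1 p2 (m + 2) x * rr q p1 p2 (m + 2) := by
  have hlim : Tendsto (fun n => hh q p1 p2 (m + 2) x * (hh q p1 p2 (m + 2) n)⁻¹) atTop
      (𝓝 (hh q p1 p2 (m + 2) x * rr q p1 p2 (m + 2))) := (rr_tendsto H m).const_mul _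
  apply le_antisymm
  · refine ge_of_tendsto hlim ?_
    filter_upwards [eventually_gt_atTop (x + m + 2)] with n hn
    have hp := hh_pos H m n (by omega)
    have := max_principle H n S
      (fun y => Minf q p1 p2 T S y - hh q p1 p2 (m + 2) y * (hh q p1 p2 (m + 2) n)⁻¹)
      (fun y hy hyS => by
        simp only [stepOp_sub, stepOp_mul]
        rw [← hh_harm H m y (fun h => hyS (h ▸ hm)), Minf_step H T S y hyS,
          updS_of_not_mem _ _ _ (fun h => hyS (hTS h))])
      (fun y hy _ => by
        simp only [Minf_mem T S y hy, hh_zero _ _ _ _ _ (hS y hy)]; simp)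
      (by
        simp only [mul_inv_cancel₀ hp.ne']
        linarith [Minf_le_one H T S n]) x (by omega)
    linarith
  · have hle1 : ∀ y, hh q p1 p2 (m + 2) y * rr q p1 p2 (m + 2) ≤ 1 := by
      intro y
      refine le_of_tendsto ((rr_tendsto H m).const_mul (hh q p1 p2 (m + 2) y)) ?_
      filter_upwards [eventually_gt_atTop (y + m + 2)] with n hn
      have hp := hh_pos H m n (by omega)
      rw [← div_eq_mul_inv, div_le_one hp]
      exact hh_mono H m (by omega)
    refine le_ciInf fun t => ?_
    have : ∀ t y, hh q p1 p2 (m + 2) y * rr q p1 p2 (m + 2) ≤ Mfin q p1 p2 T t S y := by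
      intro t
      induction t with
      | zero =>
        intro y
        simp only [Mfin]
        split_ifs with hy
        · simp [hh_zero _ _ _ _ _ (hS y hy)]
        · exact hle1 y
      | succ t ih =>
        intro y
        simp only [Mfin]
        split_ifs with hy
        · simp [hh_zero _ _ _ _ _ (hS y hy)]
        · rw [updS_of_not_mem _ _ _ (fun h => hy (hTS h)), hh_harm H m y (fun h => hy (h ▸ hm)),
            ← stepOp_mul]
          exact stepOp_mono H ih y
    exact this t x

theorem stepOp_hh (q p1 p2 : ℕ → ℝ) (m : ℕ) (c : ℝ) :
    stepOp q p1 p2 (fun y => hh q p1 p2 (m + 2) y * c) (m + 2) = q (m + 2) * c := by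
  rw [stepOp_two, hh_zero _ _ _ _ (m + 1) (by omega), hh_zero _ _ _ _ m (by omega)]
  rw [show m + 3 = m + 2 + 1 from rfl, hh_self_succ]
  ring

/-- Below the smallest point of `T`, the value is constant. -/
theorem Minf_const {q p1 p2 : ℕ → ℝ} (H : Good q p1 p2) (N : ℕ) (T S : Finset ℕ)
    (hT : ∀ x < N, x ∉ T) (hS : ∀ x < N, x ∉ S) (x : ℕ) (hx : x ≤ N) :
    Minf q p1 p2 T S x = Minf q p1 p2 T S N := by
  refine uniq H N ∅ (Minf q p1 p2 T S) (fun _ => Minf q p1 p2 T S N) ?_ ?_ ?_ rfl x hx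
  · intro y hy _
    have := Minf_step H T S y (hS y hy)
    rwa [updS_of_not_mem _ _ _ (hT y hy)] at this
  · intro y _ _; rw [stepOp_const H]
  · intro y hy; simp at hy

theorem Minf_single {q p1 p2 : ℕ → ℝ} (H : Good q p1 p2) (m : ℕ) :
    Minf q p1 p2 {m + 2} ∅ 2 = q (m + 2) * rr q p1 p2 (m + 2) := by
  rw [Minf_const H (m + 2) _ _ (by intro x hx; simp; omega) (by simp) 2 (by omega),
    Minf_step H _ _ _ (by simp), updS_of_mem _ _ _ (by simp)]
  rw [stepOp_congr _ _ _ _ (fun y => hh q p1 p2 (m + 2) y * rr q p1 p2 (m + 2)) _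
    fun y _ => Minf_avoid H m _ _ (by simp) (by simp) (by simp) y, stepOp_hh]

theorem Minf_never {q p1 p2 : ℕ → ℝ} (H : Good q p1 p2) (m : ℕ) :
    Minf q p1 p2 ∅ {m + 2} 2 = 0 := by
  rw [Minf_const H (m + 2) _ _ (by simp) (by intro x hx; simp; omega) 2 (by omega)]
  exact Minf_mem _ _ _ (by simp)

theorem Minf_pair {q p1 p2 : ℕ → ℝ} (H : Good q p1 p2) (j k : ℕ) (hjk : j < k) :
    Minf q p1 p2 {j + 2, k + 2} ∅ 2 =
      q (j + 2) * ((hh q p1 p2 (j + 2) (k + 2))⁻¹ * (q (k + 2) * rr q p1 p2 (k + 2))) := by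
  have hk : Minf q p1 p2 {j + 2, k + 2} {j + 2} (k + 2) = q (k + 2) * rr q p1 p2 (k + 2) := by
    rw [Minf_step H _ _ _ (by simp; omega), updS_of_mem _ _ _ (by simp)]
    rw [stepOp_congr _ _ _ _ (fun y => hh q p1 p2 (k + 2) y * rr q p1 p2 (k + 2)) _
      fun y _ => Minf_avoid H k _ _ (by intro z; simp; tauto) (by simp) (by simp; omega) y,
      stepOp_hh]
  have hp := hh_pos H j (k + 2) (by omega)
  have hmid : ∀ x ≤ k + 2, Minf q p1 p2 {j + 2, k + 2} {j + 2} x = hh q p1 p2 (j + 2) x *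
      ((hh q p1 p2 (j + 2) (k + 2))⁻¹ * (q (k + 2) * rr q p1 p2 (k + 2))) := by
    refine uniq H (k + 2) {j + 2} _ _ ?_ ?_ ?_ ?_
    · intro x hx hxj
      have := Minf_step H {j + 2, k + 2} {j + 2} x hxj
      rwa [updS_of_not_mem] at this
      simp at hxj ⊢; omega
    · intro x hx hxj
      rw [stepOp_mul, ← hh_harm H j x (by simpa using hxj)]
    · intro x hx _
      rw [Minf_mem _ _ _ hx, hh_zero _ _ _ _ _ (by simp at hx; omega), zero_mul]
    · rw [hk, ← mul_assoc, mul_inv_cancel₀ hp.ne', one_mul]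
  rw [Minf_const H (j + 2) _ _ (by intro x hx; simp; omega) (by simp) 2 (by omega),
    Minf_step H _ _ _ (by simp), updS_of_mem _ _ _ (by simp)]
  rw [insert_empty_eq, stepOp_congr _ _ _ _ _ _ fun y hy => hmid y (by omega), stepOp_hh]

/-! ### Link with the path measure -/

/-- Event: avoid `S`, visit points of `T` at most once, up to time `t`. -/
def Ev (T : Finset ℕ) (t : ℕ) (S : Finset ℕ) (ω : ℕ → ℕ) : Prop :=
  (∀ i ≤ t, ω i ∉ S) ∧ ∀ i i', i < i' → i' ≤ t → ω i ∈ T → ω i' ≠ ω i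

theorem Ev_zero (T S : Finset ℕ) (ω : ℕ → ℕ) : Ev T 0 S ω ↔ ω 0 ∉ S := by
  constructor
  · intro h; exact h.1 0 le_rfl
  · intro h
    refine ⟨fun i hi => ?_, fun i i' h1 h2 => by omega⟩
    obtain rfl : i = 0 := by omega
    exact h

theorem mem_updS (T S : Finset ℕ) (x y : ℕ) : y ∈ updS S T x ↔ y ∈ S ∨ (x ∈ T ∧ y = x) := by
  unfold updS; split_ifs with h <;> simp [h]; tauto

theorem Ev_succ (T : Finset ℕ) (t : ℕ) (S : Finset ℕ) (ω : ℕ → ℕ) :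
    Ev T (t + 1) S ω ↔ ω 0 ∉ S ∧ Ev T t (updS S T (ω 0)) (fun i => ω (i + 1)) := by
  simp only [Ev, mem_updS]
  constructor
  · rintro ⟨h1, h2⟩
    refine ⟨h1 0 (by omega), fun i hi => ?_, fun i i' a b c => h2 _ _ (by omega) (by omega) c⟩
    rintro (h | ⟨h, h'⟩)
    · exact h1 (i + 1) (by omega) h
    · exact h2 0 (i + 1) (by omega) (by omega) h h'
  · rintro ⟨h0, h1, h2⟩
    constructor
    · intro i hi
      rcases i with _ | i
      · exact h0
      · exact fun h => h1 i (by omega) (Or.inl h)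
    · intro i i' a b c
      obtain ⟨i', rfl⟩ : ∃ u, i' = u + 1 := ⟨i' - 1, by omega⟩
      rcases i with _ | i
      · exact fun h => h1 i' (by omega) (Or.inr ⟨c, h⟩)
      · exact h2 i i' (by omega) (by omega) c

theorem Ev_meas (T : Finset ℕ) (t : ℕ) (S : Finset ℕ) : MeasurableSet {ω | Ev T t S ω} := by
  unfold Ev
  measurability

theorem cyl_meas (m : ℕ) (x : ℕ → ℕ) : MeasurableSet {ω : ℕ → ℕ | ∀ i ≤ m, ω i = x i} := by
  measurability

theorem Ev_prob {q p1 p2 : ℕ → ℝ} (H : Good q p1 p2) (μ : Measure (ℕ → ℕ)) (init : ℕ)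
    (hμ : IsMarkovChain μ (transX q p1 p2) init) (T : Finset ℕ) (t : ℕ) :
    ∀ (m : ℕ) (x : ℕ → ℕ) (S : Finset ℕ),
      μ {ω | (∀ i ≤ m, ω i = x i) ∧ Ev T t S (fun i => ω (m + i))} =
        ENNReal.ofReal (Mfin q p1 p2 T t S (x m)) * μ {ω | ∀ i ≤ m, ω i = x i} := by
  induction t with
  | zero =>
    intro m x S
    simp only [Ev_zero, Nat.add_zero, Mfin]
    split_ifs with h
    · rw [ENNReal.ofReal_zero, zero_mul]
      convert measure_empty (μ := μ)
      ext ω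
      simp only [Set.mem_ofPred_eq, Set.mem_empty_iff_false, iff_false, not_and, not_not]
      intro h'; rw [h' m le_rfl]; exact h
    · rw [ENNReal.ofReal_one, one_mul]
      congr 1
      ext ω
      simp only [Set.mem_ofPred_eq, and_iff_left_iff_imp]
      intro h'; rw [h' m le_rfl]; exact h
  | succ t ih =>
    intro m x S
    simp only [Ev_succ, Nat.add_zero, Mfin]
    split_ifs with h
    · rw [ENNReal.ofReal_zero, zero_mul]
      convert measure_empty (μ := μ)
      ext ω
      simp only [Set.mem_ofPred_eq, Set.mem_empty_iff_false, iff_false, not_and]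
      intro ha hb; rw [ha m le_rfl] at hb; exact absurd h hb
    · have key : {ω : ℕ → ℕ | (∀ i ≤ m, ω i = x i) ∧ ω m ∉ S ∧
          Ev T t (updS S T (ω m)) (fun i => ω (m + (i + 1)))} =
          ⋃ y : ℕ, {ω | (∀ i ≤ m + 1, ω i = Function.update x (m + 1) y i) ∧
            Ev T t (updS S T (x m)) (fun i => ω (m + 1 + i))} := by
        have e : ∀ i, m + (i + 1) = m + 1 + i := fun i => by omega
        have e' : ∀ ω : ℕ → ℕ, (fun i => ω (m + (i + 1))) = fun i => ω (m + 1 + i) :=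
          fun ω => funext fun i => by rw [e]
        ext ω
        rw [Set.mem_iUnion]
        simp only [Set.mem_ofPred_eq, e']
        constructor
        · rintro ⟨a, b, c⟩
          refine ⟨ω (m + 1), fun i hi => ?_, by rwa [a m le_rfl] at c⟩
          rcases Nat.lt_or_ge m i with h1 | h1
          · obtain rfl : i = m + 1 := by omega
            simp
          · rw [Function.update_of_ne (by omega), a i h1]
        · rintro ⟨y, a, c⟩
          have a' : ∀ i ≤ m, ω i = x i := fun i hi => by
            rw [a i (by omega), Function.update_of_ne (by omega)]
          refine ⟨a', ?_, ?_⟩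
          · rw [a' m le_rfl]; exact h
          · rw [a' m le_rfl]; exact c
      rw [key, measure_iUnion]
      · simp only [ih]
        have e2 : ∀ y, μ {ω : ℕ → ℕ | ∀ i ≤ m + 1, ω i = Function.update x (m + 1) y i} =
            ENNReal.ofReal (transX q p1 p2 (x m) y) * μ {ω | ∀ i ≤ m, ω i = x i} := by
          intro y
          rw [← hμ.2 m x y]
          congr 1
          ext ω
          simp only [Set.mem_ofPred_eq]
          constructor
          · intro a
            refine ⟨fun i hi => ?_, ?_⟩
            · rw [a i (by omega), Function.update_of_ne (by omega)]
            · rw [a (m + 1) le_rfl]; simp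
          · rintro ⟨a, b⟩ i hi
            rcases Nat.lt_or_ge m i with h1 | h1
            · obtain rfl : i = m + 1 := by omega
              simp [b]
            · rw [Function.update_of_ne (by omega), a i h1]
        simp only [e2, Function.update_self]
        simp only [← mul_assoc]
        rw [ENNReal.tsum_mul_right]
        congr 1
        rw [tsum_eq_sum (s := Finset.range (x m + 2)), stepOp, ENNReal.ofReal_sum_of_nonneg]
        · refine Finset.sum_congr rfl fun y _ => ?_
          rw [mul_comm, ENNReal.ofReal_mul (transX_nonneg H _ _)]
        · exact fun y _ => mul_nonneg (transX_nonneg H _ _) (Mfin_nonneg H _ _ _ _)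
        · intro y hy
          rw [transX_eq_zero _ _ _ _ _ (by simpa using hy)]
          simp
      · intro y y' hyy
        refine Set.disjoint_left.2 fun ω h1 h2 => hyy ?_
        have a := h1.1 (m + 1) le_rfl
        have b := h2.1 (m + 1) le_rfl
        simp at a b
        omega
      · intro y
        refine (cyl_meas _ _).inter ?_
        have hm : Measurable fun (ω : ℕ → ℕ) (i : ℕ) => ω (m + 1 + i) :=
          measurable_pi_lambda _ fun i => measurable_pi_apply _
        exact hm (Ev_meas T t (updS S T (x m)))

theorem Ev_inf_prob {q p1 p2 : ℕ → ℝ} (H : Good q p1 p2) (μ : Measure (ℕ → ℕ))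
    [IsProbabilityMeasure μ] (hμ : IsMarkovChain μ (transX q p1 p2) 2) (T S : Finset ℕ) :
    μ {ω | ∀ t, Ev T t S ω} = ENNReal.ofReal (Minf q p1 p2 T S 2) := by
  have hfin : ∀ t, μ {ω | Ev T t S ω} = ENNReal.ofReal (Mfin q p1 p2 T t S 2) := by
    intro t
    have h0 := Ev_prob H μ 2 hμ T t 0 (fun _ => 2) S
    have e : {ω : ℕ → ℕ | ∀ i ≤ 0, ω i = 2} = {ω | ω 0 = 2} := by ext; simp
    rw [e, hμ.1, mul_one] at h0
    rw [← h0]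
    have hae : ∀ᵐ ω ∂μ, ω 0 = 2 := by
      have hm : MeasurableSet {ω : ℕ → ℕ | ω 0 = 2} := e ▸ cyl_meas 0 (fun _ => 2)
      exact (prob_compl_eq_zero_iff hm).2 hμ.1
    refine measure_congr ?_
    filter_upwards [hae] with ω hω
    refine propext ?_
    change Ev T t S ω ↔ (∀ i ≤ 0, ω i = 2) ∧ Ev T t S fun i => ω (0 + i)
    simp [hω]
  have hanti : Antitone fun t => {ω : ℕ → ℕ | Ev T t S ω} := by
    intro s t hst ω h
    exact ⟨fun i hi => h.1 i (hi.trans hst), fun i i' a b => h.2 i i' a (b.trans hst)⟩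
  have h1 := tendsto_measure_iInter_atTop (μ := μ)
    (fun t => (Ev_meas T t S).nullMeasurableSet) hanti ⟨0, measure_ne_top _ _⟩
  have h2 : (⋂ t, {ω : ℕ → ℕ | Ev T t S ω}) = {ω | ∀ t, Ev T t S ω} := by
    ext; simp
  rw [h2] at h1
  refine tendsto_nhds_unique h1 ?_
  simp only [Function.comp_def, hfin]
  exact (ENNReal.continuous_ofReal.tendsto _).comp (Mfin_tendsto H T S 2)

theorem ae_visit {q p1 p2 : ℕ → ℝ} (H : Good q p1 p2) (μ : Measure (ℕ → ℕ))
    [IsProbabilityMeasure μ] (hμ : IsMarkovChain μ (transX q p1 p2) 2) (m : ℕ) :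
    ∀ᵐ ω ∂μ, ∃ n, ω n = m + 2 := by
  have := Ev_inf_prob H μ hμ ∅ {m + 2}
  rw [Minf_never H, ENNReal.ofReal_zero] at this
  rw [ae_iff]
  refine measure_mono_null ?_ this
  intro ω h
  simp only [Set.mem_ofPred_eq, not_exists] at h
  intro t
  exact ⟨fun i _ => by simpa using h i, by simp⟩

theorem Ev_all (T : Finset ℕ) (ω : ℕ → ℕ) :
    (∀ t, Ev T t ∅ ω) ↔ ∀ y ∈ T, ∀ i i', ω i = y → ω i' = y → i = i' := by
  constructor
  · intro h y hy i i' a b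
    rcases lt_trichotomy i i' with c | c | c
    · exact absurd (b.trans a.symm) ((h i').2 i i' c le_rfl (a ▸ hy))
    · exact c
    · exact absurd (a.trans b.symm) ((h i).2 i' i c le_rfl (b ▸ hy))
  · intro h t
    refine ⟨by simp, fun i i' a _ c d => ?_⟩
    have := h (ω i) c i i' rfl d
    omega

theorem exUnique_iff (ω : ℕ → ℕ) (y : ℕ) (h : ∃ n, ω n = y) :
    (∃! n, ω n = y) ↔ ∀ i i', ω i = y → ω i' = y → i = i' := by
  constructor
  · intro h i i' a b; exact h.unique a b
  · intro h'
    obtain ⟨n, hn⟩ := h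
    exact ⟨n, hn, fun z hz => h' z n hz hn⟩

theorem cutpoint_probabilities_X
    (q p1 p2 : ℕ → ℝ)
    (hq : ∀ k, 2 ≤ k → 0 < q k) (hp1 : ∀ k, 2 ≤ k → 0 ≤ p1 k)
    (hp2 : ∀ k, 2 ≤ k → 0 < p2 k)
    (hsum : ∀ k, 2 ≤ k → q k + p1 k + p2 k = 1)
    (μ : Measure (ℕ → ℕ)) [IsProbabilityMeasure μ]
    (hμ : IsMarkovChain μ (transX q p1 p2) 2) :
    (∀ k : ℕ, 2 ≤ k →
      μ {ω | ∃! n, ω n = k} = ENNReal.ofReal (q k) / FXinf q p1 p2 k) ∧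
    (∀ j k : ℕ, 2 ≤ j → j < k →
      μ {ω | (∃! n, ω n = j) ∧ (∃! n, ω n = k)}
        = (ENNReal.ofReal (q j) * ENNReal.ofReal (q k))
          / (ENNReal.ofReal (FXfin q p1 p2 j k) * FXinf q p1 p2 k)) := by
  have H : Good q p1 p2 := ⟨hq, hp1, hp2, hsum⟩
  constructor
  · intro k hk
    obtain ⟨k, rfl⟩ : ∃ u, k = u + 2 := ⟨k - 2, by omega⟩
    have h1 : μ {ω | ∃! n, ω n = k + 2} = μ {ω | ∀ t, Ev {k + 2} t ∅ ω} := by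
      refine measure_congr ?_
      filter_upwards [ae_visit H μ hμ k] with ω hω
      refine propext ?_
      change (∃! n, ω n = k + 2) ↔ ∀ t, Ev {k + 2} t ∅ ω
      rw [Ev_all, exUnique_iff _ _ hω]
      simp
    rw [h1, Ev_inf_prob H μ hμ, Minf_single H, ENNReal.ofReal_mul (hq _ hk).le, div_eq_mul_inv,
      FXinf_inv]
  · intro j k hj hjk
    obtain ⟨k, rfl⟩ : ∃ u, k = u + 2 := ⟨k - 2, by omega⟩
    obtain ⟨j, rfl⟩ : ∃ u, j = u + 2 := ⟨j - 2, by omega⟩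
    have h1 : μ {ω | (∃! n, ω n = j + 2) ∧ (∃! n, ω n = k + 2)} =
        μ {ω | ∀ t, Ev {j + 2, k + 2} t ∅ ω} := by
      refine measure_congr ?_
      filter_upwards [ae_visit H μ hμ k, ae_visit H μ hμ j] with ω hω hω'
      refine propext ?_
      change ((∃! n, ω n = j + 2) ∧ (∃! n, ω n = k + 2)) ↔ ∀ t, Ev {j + 2, k + 2} t ∅ ω
      rw [Ev_all, exUnique_iff _ _ hω, exUnique_iff _ _ hω']
      simp
    have hp := hh_pos H j (k + 2) hjk
    rw [h1, Ev_inf_prob H μ hμ, Minf_pair H j k (by omega), ENNReal.ofReal_mul (hq _ hj).le,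
      ENNReal.ofReal_mul (inv_nonneg.2 hp.le), ENNReal.ofReal_mul (hq _ (by omega)).le,
      FXfin_eq _ _ _ _ _ hjk, div_eq_mul_inv, ENNReal.mul_inv (Or.inl (by simpa using hp))
        (Or.inl ENNReal.ofReal_ne_top), FXinf_inv, ENNReal.ofReal_inv_of_pos hp]
    ring

end
end
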